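/- arXiv:1501.06489 — 4 statements merged into one kernel-verified Lean document; each statement's English description precedes it below -/
import Mathlib

section
/- Let N be a positive integer, H a finite-dimensional complex inner product space, U a unitary representation of ZMod N on H, and Q : ZMod N → (H →L[ℂ] H) a complete orthogonal family of projections. For E : ZMod N define V_E := ∑_{s : ZMod N} χ_E(s) • Q_s. Then the Weyl canonical commutation relations V_E ∘ U(t) = χ_E(t) • (U(t) ∘ V_E) hold for all t, E : ZMod N if and only if U(t) ∘ Q_s = Q_{s+t} ∘ U(t) for all s, t : ZMod N. -/
open scoped BigOperators InnerProductSpace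

/-- The multiplicative characters (energy levels) of `ZMod N`. -/
noncomputable def chi (N : ℕ) (E t : ZMod N) : ℂ :=
  Complex.exp (2 * Real.pi * Complex.I * (E.val * t.val) / N)

theorem chi_eq_stdAddChar (N : ℕ) [NeZero N] (E t : ZMod N) :
    chi N E t = ZMod.stdAddChar (E * t) := by
  have h := ZMod.stdAddChar_coe (N := N) ((E.val : ℤ) * (t.val : ℤ))
  push_cast at h
  rw [ZMod.natCast_zmod_val, ZMod.natCast_zmod_val] at h
  rw [h, chi]

theorem chi_add (N : ℕ) [NeZero N] (E s t : ZMod N) :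
    chi N E (s + t) = chi N E s * chi N E t := by
  simp only [chi_eq_stdAddChar, mul_add, AddChar.map_add_eq_mul]

/-- A function on `ZMod N` is determined by its sums against all the characters. -/
theorem eq_of_sum_chi_smul_eq {N : ℕ} [NeZero N] {M : Type*} [AddCommGroup M] [Module ℂ M]
    {f g : ZMod N → M} (h : ∀ E, ∑ s, chi N E s • f s = ∑ s, chi N E s • g s) : f = g := by
  apply (ZMod.dft (N := N) (E := M)).injective
  funext k
  simpa only [ZMod.dft_apply, chi_eq_stdAddChar, neg_mul, mul_neg, mul_comm k] using h (-k)

/-- The Weyl canonical commutation relations between the unitaries `V_E` built from a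
complete orthogonal family of projections `Q` and the dynamic `U` hold if and only if
`Q` is covariant under time translation: `U t ∘ Q s = Q (s+t) ∘ U t`. -/
theorem weyl_ccr_iff_covariance
    (N : ℕ) [NeZero N] {H : Type*} [NormedAddCommGroup H] [InnerProductSpace ℂ H]
    [FiniteDimensional ℂ H]
    (U : ZMod N → (H →L[ℂ] H))
    (hU0 : U 0 = 1)
    (hUadd : ∀ s t : ZMod N, U (s + t) = U s ∘L U t)
    (hUunitary : ∀ (t : ZMod N) (v w : H), ⟪U t v, U t w⟫_ℂ = ⟪v, w⟫_ℂ)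
    (Q : ZMod N → (H →L[ℂ] H))
    (hQsa : ∀ s, IsSelfAdjoint (Q s))
    (hQidem : ∀ s, Q s ∘L Q s = Q s)
    (hQorth : ∀ s s', s ≠ s' → Q s ∘L Q s' = 0)
    (hQsum : (∑ s : ZMod N, Q s) = 1) :
    (∀ t E : ZMod N,
        (∑ s : ZMod N, chi N E s • Q s) ∘L U t
          = chi N E t • (U t ∘L (∑ s : ZMod N, chi N E s • Q s)))
      ↔ (∀ s t : ZMod N, U t ∘L Q s = Q (s + t) ∘L U t) := by
  have left_expand : ∀ t E : ZMod N, (∑ s, chi N E s • Q s) ∘L U t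
      = ∑ s, chi N E (s + t) • (Q (s + t) ∘L U t) := fun t E => by
    rw [← Equiv.sum_comp (Equiv.addRight t) (fun s => chi N E s • Q s)]
    simp [ContinuousLinearMap.finsetSum_comp]
  have right_expand : ∀ t E : ZMod N, chi N E t • (U t ∘L ∑ s, chi N E s • Q s)
      = ∑ s, chi N E (s + t) • (U t ∘L Q s) := fun t E => by
    simp [ContinuousLinearMap.comp_finsetSum, Finset.smul_sum, chi_add, smul_smul, mul_comm]
  simp only [left_expand, right_expand]
  constructor
  · intro h s t
    have key : (fun r => U t ∘L Q (r - t)) = fun r => Q r ∘L U t := by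
      refine eq_of_sum_chi_smul_eq fun E => ?_
      rw [← Equiv.sum_comp (Equiv.addRight t),
        ← Equiv.sum_comp (Equiv.addRight t) (fun r => chi N E r • (Q r ∘L U t))]
      simpa using (h t E).symm
    simpa using congrFun key (s + t)
  · intro h t E
    simp only [h]
end

section
/- Let N be a positive integer, H a finite-dimensional complex inner product space, U a unitary representation of ZMod N on H, and Q : ZMod N → (H →L[ℂ] H) a complete orthogonal family of projections satisfying the covariance relation U(t) ∘ Q_s = Q_{s+t} ∘ U(t) for all s, t : ZMod N. If ψ ∈ H is a unit vector and there is E : ZMod N with U(t) ψ = χ_E(t) • ψ for every t : ZMod N, then ‖Q_s ψ‖² = 1/N for every s : ZMod N (the measurement distribution is uniform). -/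
open scoped BigOperators InnerProductSpace

/-- The time/energy uncertainty principle: measuring an energy eigenstate with respect to a
covariant complete orthogonal family of projections yields the uniform distribution. -/
theorem uncertainty_principle
    (N : ℕ) [NeZero N] {H : Type*} [NormedAddCommGroup H] [InnerProductSpace ℂ H]
    [FiniteDimensional ℂ H]
    (U : ZMod N → (H →L[ℂ] H))
    (hU0 : U 0 = 1)
    (hUadd : ∀ s t : ZMod N, U (s + t) = U s ∘L U t)
    (hUunitary : ∀ (t : ZMod N) (v w : H), ⟪U t v, U t w⟫_ℂ = ⟪v, w⟫_ℂ)
    (Q : ZMod N → (H →L[ℂ] H))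
    (hQsa : ∀ s, IsSelfAdjoint (Q s))
    (hQidem : ∀ s, Q s ∘L Q s = Q s)
    (hQorth : ∀ s s', s ≠ s' → Q s ∘L Q s' = 0)
    (hQsum : (∑ s : ZMod N, Q s) = 1)
    (hcov : ∀ s t : ZMod N, U t ∘L Q s = Q (s + t) ∘L U t)
    (ψ : H) (hψ : ‖ψ‖ = 1)
    (E : ZMod N) (hE : ∀ t : ZMod N, U t ψ = chi N E t • ψ) :
    ∀ s : ZMod N, ‖Q s ψ‖ ^ 2 = 1 / (N : ℝ) := by
  have hchi (t : ZMod N) : ‖chi N E t‖ = 1 := by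
    have h : (2 * Real.pi * Complex.I * (E.val * t.val) / N : ℂ) =
        ((2 * Real.pi * (E.val * t.val) / N : ℝ) : ℂ) * Complex.I := by
      push_cast
      ring
    rw [chi, h, Complex.norm_exp_ofReal_mul_I]
  have hnorm (t : ZMod N) (v : H) : ‖U t v‖ = ‖v‖ := by
    rw [norm_eq_sqrt_re_inner (𝕜 := ℂ), hUunitary, ← norm_eq_sqrt_re_inner]
  have hconst (s t : ZMod N) : ‖Q (s + t) ψ‖ = ‖Q s ψ‖ := by
    have h := DFunLike.congr_fun (hcov s t) ψ
    simp only [ContinuousLinearMap.comp_apply, hE, map_smul] at h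
    rw [← hnorm t (Q s ψ), h, norm_smul, hchi, one_mul]
  have hsq (s : ZMod N) : ((‖Q s ψ‖ ^ 2 : ℝ) : ℂ) = ⟪ψ, Q s ψ⟫_ℂ := by
    have h : ⟪Q s ψ, Q s ψ⟫_ℂ = ⟪ψ, Q s (Q s ψ)⟫_ℂ := (hQsa s).isSymmetric ψ (Q s ψ)
    rw [← ContinuousLinearMap.comp_apply, hQidem, inner_self_eq_norm_sq_to_K] at h
    simpa using h
  have hsum : ∑ s : ZMod N, ‖Q s ψ‖ ^ 2 = 1 := by
    have h : ((∑ s : ZMod N, ‖Q s ψ‖ ^ 2 : ℝ) : ℂ) = 1 := by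
      rw [Complex.ofReal_sum, Finset.sum_congr rfl fun s _ => hsq s, ← inner_sum,
        ← sum_apply, hQsum, one_apply_eq_self,
        inner_self_eq_norm_sq_to_K, hψ]
      simp
    exact_mod_cast h
  intro s
  have hall (r : ZMod N) : ‖Q r ψ‖ ^ 2 = ‖Q s ψ‖ ^ 2 := by
    rw [← hconst s (r - s), add_sub_cancel]
  rw [Finset.sum_congr rfl fun r _ => hall r, Finset.sum_const, Finset.card_univ,
    ZMod.card, nsmul_eq_mul] at hsum
  exact eq_one_div_of_mul_eq_one_right hsum
end

section
/- Let N be a positive integer, H a finite-dimensional complex inner product space, and U a unitary representation of ZMod N on H. For Ψ : ZMod N → H define its Fourier transform Φ : ZMod N → H by Φ(E) := (1/N) • ∑_{t : ZMod N} conj(χ_E(t)) • Ψ(t). Then Ψ is a concrete history (i.e. Ψ(t) = U(t)(Ψ(0)) for all t) if and only if Ψ solves Schrödinger's equation in the energy picture, i.e. U(t)(Φ(E)) = χ_E(t) • Φ(E) for all t, E : ZMod N. -/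
open scoped BigOperators InnerProductSpace

theorem conj_chi (N : ℕ) [NeZero N] (E t : ZMod N) :
    (starRingEnd ℂ) (chi N E t) = ZMod.stdAddChar (-(t * E)) := by
  rw [chi_eq_stdAddChar, mul_comm, ZMod.stdAddChar_apply, ZMod.stdAddChar_apply,
    AddChar.map_neg_eq_inv, Circle.coe_inv_eq_conj]

/-- Fourier inversion on `ZMod N`, without division by `N`. -/
theorem natCast_smul_eq_sum_dft {N : ℕ} [NeZero N] {H : Type*} [AddCommGroup H] [Module ℂ H]
    (Ψ : ZMod N → H) (t : ZMod N) :
    (N : ℂ) • Ψ t = ∑ E : ZMod N, ZMod.stdAddChar (E * t) • ZMod.dft Ψ E := by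
  have h := congrFun (ZMod.dft_dft Ψ) (-t)
  rw [ZMod.dft_apply, neg_neg] at h
  simpa only [mul_neg, neg_neg] using h.symm

/-- Schrödinger's equation: a map `Ψ : ZMod N → H` is a concrete history of the dynamic `U`
if and only if its Fourier transform `Φ` satisfies the eigenvalue equations
`U t (Φ E) = chi N E t • Φ E` (Schrödinger's equation in the energy picture). -/
theorem schrodinger_equation
    (N : ℕ) [NeZero N] {H : Type*} [NormedAddCommGroup H] [InnerProductSpace ℂ H]
    [FiniteDimensional ℂ H]
    (U : ZMod N → (H →L[ℂ] H))
    (hU0 : U 0 = 1)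
    (hUadd : ∀ s t : ZMod N, U (s + t) = U s ∘L U t)
    (hUunitary : ∀ (t : ZMod N) (v w : H), ⟪U t v, U t w⟫_ℂ = ⟪v, w⟫_ℂ)
    (Ψ : ZMod N → H)
    (Φ : ZMod N → H)
    (hΦ : ∀ E : ZMod N,
      Φ E = (1 / (N : ℂ)) • ∑ t : ZMod N, (starRingEnd ℂ) (chi N E t) • Ψ t) :
    (∀ t : ZMod N, Ψ t = U t (Ψ 0)) ↔
      (∀ t E : ZMod N, U t (Φ E) = chi N E t • Φ E) := by
  have hΦ' (E : ZMod N) : Φ E = (N : ℂ)⁻¹ • ZMod.dft Ψ E := by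
    simp [hΦ, ZMod.dft_apply, conj_chi]
  have hN : (N : ℂ) ≠ 0 := NeZero.ne _
  have key : (∀ t E : ZMod N, U t (Φ E) = chi N E t • Φ E) ↔
      ∀ t E : ZMod N, U t (ZMod.dft Ψ E) = ZMod.stdAddChar (E * t) • ZMod.dft Ψ E := by
    refine forall₂_congr fun t E ↦ ?_
    rw [hΦ', map_smul, smul_comm, chi_eq_stdAddChar]
    exact (smul_right_injective H (inv_ne_zero hN)).eq_iff
  rw [key]
  constructor
  · intro h s E
    have hs (t : ZMod N) : U s (Ψ t) = Ψ (s + t) := by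
      rw [h t, h (s + t), hUadd, ContinuousLinearMap.comp_apply]
    simp only [ZMod.dft_apply, map_sum, map_smul, hs, Finset.smul_sum, smul_smul,
      ← AddChar.map_add_eq_mul]
    refine Fintype.sum_equiv (Equiv.addLeft s) _ _ fun t ↦ ?_
    rw [Equiv.coe_addLeft]
    congr 2
    ring
  · intro h t
    apply smul_right_injective H hN
    change (N : ℂ) • Ψ t = (N : ℂ) • U t (Ψ 0)
    rw [← map_smul, natCast_smul_eq_sum_dft Ψ t, natCast_smul_eq_sum_dft Ψ 0, map_sum]
    exact Finset.sum_congr rfl fun E _ ↦ by simp [h]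
end

section
/- Let N be a positive integer, H a finite-dimensional complex inner product space, and (U_t)_{t : ZMod N} a family of unitary linear operators on H (the gates of a cyclic quantum circuit). Define the circuit evolution operator W on the space of functions f : ZMod N → H by (W f)(t) := U_t(f(t − 1)). Then: (i) W preserves the inner product ⟨f, g⟩ = ∑_{t : ZMod N} ⟨f(t), g(t)⟩, and (ii) W f = f if and only if the state ψ := f(0) is fixed by the monodromy operator U_0 ∘ U_{N−1} ∘ ⋯ ∘ U_1 and, for every natural number k with 0 < k < N, f(k) = (U_k ∘ U_{k−1} ∘ ⋯ ∘ U_1)(ψ). In other words, the fixed vectors of W are exactly the history states ∑_t ψ_t ⊗ |t⟩ with ψ_{t+1} = U_{t+1}(ψ_t). -/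
open scoped BigOperators InnerProductSpace

/-- The composite `U_k ∘ U_{k-1} ∘ ⋯ ∘ U_1` of the first `k` gates of a cyclic quantum
circuit (the empty composite being the identity). -/
noncomputable def gateProd {N : ℕ} {H : Type*} [NormedAddCommGroup H]
    [InnerProductSpace ℂ H] (U : ZMod N → (H →L[ℂ] H)) : ℕ → (H →L[ℂ] H)
  | 0 => 1
  | k + 1 => U ((k + 1 : ℕ) : ZMod N) ∘L gateProd U k

/-- A fixed vector of the circuit evolution operator is propagated by the gates. -/
theorem apply_natCast_eq_gateProd {N : ℕ} {H : Type*} [NormedAddCommGroup H]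
    [InnerProductSpace ℂ H] {U : ZMod N → (H →L[ℂ] H)} {f : ZMod N → H}
    (hf : ∀ t, U t (f (t - 1)) = f t) (k : ℕ) :
    f (k : ZMod N) = gateProd U k (f 0) := by
  induction k with
  | zero => simp [gateProd]
  | succ k ih =>
    rw [← hf, gateProd, ContinuousLinearMap.comp_apply, ← ih]
    simp

/-- A family given by the gate products on `k < N`, starting from a state fixed by the
monodromy, is fixed by the circuit evolution operator. -/
theorem apply_eq_of_gateProd {N : ℕ} [NeZero N] {H : Type*} [NormedAddCommGroup H]
    [InnerProductSpace ℂ H] {U : ZMod N → (H →L[ℂ] H)} {f : ZMod N → H}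
    (h0 : U 0 (gateProd U (N - 1) (f 0)) = f 0)
    (hf : ∀ k < N, f (k : ZMod N) = gateProd U k (f 0)) (t : ZMod N) :
    U t (f (t - 1)) = f t := by
  have hN : 0 < N := NeZero.pos N
  obtain ⟨k, hk, rfl⟩ : ∃ k < N, (k : ZMod N) = t :=
    ⟨t.val, t.val_lt, ZMod.natCast_zmod_val t⟩
  cases k with
  | zero =>
    have hpred : ((N - 1 : ℕ) : ZMod N) = 0 - 1 := by
      rw [Nat.cast_sub hN]
      simp
    rw [Nat.cast_zero, ← hpred, hf _ (by omega), h0]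
  | succ k =>
    have hpred : ((k + 1 : ℕ) : ZMod N) - 1 = k := by simp
    rw [hpred, hf k (by omega), hf _ hk, gateProd, ContinuousLinearMap.comp_apply]

/-- Feynman's clock for cyclic quantum circuits: the circuit evolution operator
`(W f) t = U t (f (t - 1))` on the space of functions `ZMod N → H` preserves the inner
product, and its fixed vectors are exactly the history states: the families
`t ↦ ψ_t` with `ψ_0` fixed by the monodromy `U_0 ∘ U_{N-1} ∘ ⋯ ∘ U_1` and
`ψ_k = (U_k ∘ ⋯ ∘ U_1) ψ_0` for `0 < k < N`. -/
theorem feynman_clock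
    (N : ℕ) [NeZero N] {H : Type*} [NormedAddCommGroup H] [InnerProductSpace ℂ H]
    [FiniteDimensional ℂ H]
    (U : ZMod N → (H →L[ℂ] H))
    (hUunitary : ∀ (t : ZMod N) (v w : H), ⟪U t v, U t w⟫_ℂ = ⟪v, w⟫_ℂ)
    (hUbij : ∀ t : ZMod N, Function.Bijective (U t)) :
    (∀ f g : ZMod N → H,
      ∑ t : ZMod N, ⟪U t (f (t - 1)), U t (g (t - 1))⟫_ℂ
        = ∑ t : ZMod N, ⟪f t, g t⟫_ℂ) ∧
    (∀ f : ZMod N → H,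
      (fun t : ZMod N => U t (f (t - 1))) = f ↔
        ((U 0 ∘L gateProd U (N - 1)) (f 0) = f 0 ∧
          ∀ k : ℕ, 0 < k → k < N → f ((k : ℕ) : ZMod N) = gateProd U k (f 0))) := by
  refine ⟨fun f g => ?_, fun f => ⟨fun h => ?_, fun ⟨h0, h⟩ => funext ?_⟩⟩
  · simp_rw [hUunitary]
    exact (Equiv.subRight (1 : ZMod N)).sum_comp fun t => ⟪f t, g t⟫_ℂ
  · have hf : ∀ t, U t (f (t - 1)) = f t := congrFun h
    refine ⟨?_, fun k _ _ => apply_natCast_eq_gateProd hf k⟩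
    have hpred : ((N - 1 : ℕ) : ZMod N) = 0 - 1 := by
      rw [Nat.cast_sub (NeZero.pos N)]
      simp
    rw [ContinuousLinearMap.comp_apply, ← apply_natCast_eq_gateProd hf, hpred, hf]
  · refine apply_eq_of_gateProd h0 fun k hk => ?_
    rcases k.eq_zero_or_pos with rfl | hpos
    · simp [gateProd]
    · exact h k hpos hk
end
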